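/- arXiv:math/0607493 — 10 statements merged into one kernel-verified Lean document; each statement's English description precedes it below -/
import Mathlib

section
/- Let n ≥ 1, let m : Fin n → ℝ³ be a family of unit vectors, let α > 0 and ω > 0 be real numbers, and let H be a real symmetric matrix indexed by (Fin n) × (Fin 3). Then the complex matrix M_ω = (i·ω)·I − D_ℂ · H_ℂ is invertible (where D_ℂ and H_ℂ denote the entrywise complexifications of the block-diagonal matrix D built from m and α, and of H). -/
noncomputable section

/-- Cross product on `ℝ³` (Euclidean space). -/
def cross3 (a b : EuclideanSpace ℝ (Fin 3)) : EuclideanSpace ℝ (Fin 3) :=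
  (WithLp.equiv 2 (Fin 3 → ℝ)).symm
    ![a 1 * b 2 - a 2 * b 1, a 2 * b 0 - a 0 * b 2, a 0 * b 1 - a 1 * b 0]

/-- The map `D_m : w ↦ −m ×ᵥ w − α • (m ×ᵥ (m ×ᵥ w))`. -/
def Dmap (α : ℝ) (m w : EuclideanSpace ℝ (Fin 3)) : EuclideanSpace ℝ (Fin 3) :=
  -cross3 m w - α • cross3 m (cross3 m w)

/-- The 3×3 matrix of the linear map `D_m` (columns are the images of the standard basis). -/
def DmMat (α : ℝ) (m : EuclideanSpace ℝ (Fin 3)) : Matrix (Fin 3) (Fin 3) ℝ :=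
  Matrix.of fun i j => Dmap α m ((WithLp.equiv 2 (Fin 3 → ℝ)).symm (Pi.single j 1)) i

/-- The block-diagonal matrix `D` on `ℝ^(3n)` whose `i`-th 3×3 diagonal block is the
matrix of `D_{m i}` and whose off-diagonal blocks vanish. -/
def blockD (n : ℕ) (α : ℝ) (m : Fin n → EuclideanSpace ℝ (Fin 3)) :
    Matrix (Fin n × Fin 3) (Fin n × Fin 3) ℝ :=
  Matrix.of fun p q => if p.1 = q.1 then DmMat α (m p.1) p.2 q.2 else 0

open Matrix in
/-- If `S` is skew-Hermitian, `H` is Hermitian, and `α`, `ω` are nonzero reals, then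
`i ω - (S - α S²) H` is invertible. -/
theorem isUnit_I_smul_one_sub_skew_mul {ι : Type*} [Fintype ι] [DecidableEq ι]
    {S H : Matrix ι ι ℂ} (hS : Sᴴ = -S) (hH : H.IsHermitian) {α ω : ℝ} (hα : α ≠ 0)
    (hω : ω ≠ 0) :
    IsUnit ((Complex.I * ω) • (1 : Matrix ι ι ℂ) - (S - (α : ℂ) • (S * S)) * H) := by
  have hIω : Complex.I * ω ≠ 0 := mul_ne_zero Complex.I_ne_zero (by exact_mod_cast hω)
  rw [← mulVec_injective_iff_isUnit]
  change Function.Injective (mulVecLin _)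
  rw [injective_iff_map_eq_zero]
  intro v hv
  rw [mulVecLin_apply, sub_mulVec, smul_mulVec, one_mulVec, ← mulVec_mulVec, sub_eq_zero,
    sub_mulVec, smul_mulVec, ← mulVec_mulVec] at hv
  set h := H *ᵥ v with hh
  have key : (Complex.I * ω) * (star h ⬝ᵥ v) =
      star h ⬝ᵥ (S *ᵥ h) + α * (star (S *ᵥ h) ⬝ᵥ (S *ᵥ h)) := by
    have := congrArg (star h ⬝ᵥ ·) hv
    simp only [dotProduct_smul, dotProduct_sub, smul_eq_mul] at this
    rw [this, star_mulVec S h, hS, ← dotProduct_mulVec, neg_mulVec, dotProduct_neg]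
    ring
  have hv_real : star (star h ⬝ᵥ v) = star h ⬝ᵥ v := by
    rw [← star_dotProduct_star, star_star, hh, star_mulVec, hH.eq, ← dotProduct_mulVec]
  have hskew : star (star h ⬝ᵥ (S *ᵥ h)) = -(star h ⬝ᵥ (S *ᵥ h)) := by
    rw [← star_dotProduct_star, star_star, star_mulVec, hS, ← dotProduct_mulVec,
      neg_mulVec, dotProduct_neg]
  have hnorm : star (star (S *ᵥ h) ⬝ᵥ (S *ᵥ h)) = star (S *ᵥ h) ⬝ᵥ (S *ᵥ h) := by
    rw [← star_dotProduct_star, star_star]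
  have key' := congrArg star key
  simp only [star_add, star_mul', hv_real, hskew, hnorm, Complex.star_def, Complex.conj_I,
    Complex.conj_ofReal] at key'
  have hzero : (α : ℂ) * (star (S *ᵥ h) ⬝ᵥ (S *ᵥ h)) = 0 := by
    linear_combination -(key + key') / 2
  have hSh : S *ᵥ h = 0 := by
    open scoped ComplexOrder in rw [← dotProduct_star_self_eq_zero]
    exact (mul_eq_zero.mp hzero).resolve_left (by exact_mod_cast hα)
  rw [hSh, mulVec_zero, smul_zero, sub_zero] at hv
  exact (smul_eq_zero.mp hv).resolve_left hIω

/-- The matrix of `w ↦ -(m × w)`. -/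
def negCrossMat (m : EuclideanSpace ℝ (Fin 3)) : Matrix (Fin 3) (Fin 3) ℝ :=
  !![0, m 2, -m 1; -m 2, 0, m 0; m 1, -m 0, 0]

open Matrix in
theorem negCrossMat_transpose (m : EuclideanSpace ℝ (Fin 3)) :
    (negCrossMat m)ᵀ = -negCrossMat m := by
  ext i j
  fin_cases i <;> fin_cases j <;> simp [negCrossMat]

theorem DmMat_eq (α : ℝ) (m : EuclideanSpace ℝ (Fin 3)) :
    DmMat α m = negCrossMat m - α • (negCrossMat m * negCrossMat m) := by
  ext i j
  fin_cases i <;> fin_cases j <;>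
    simp [DmMat, Dmap, cross3, negCrossMat, -mul_eq_mul_left_iff] <;> ring

/-- The block-diagonal matrix with blocks `w ↦ -(m i × w)`. -/
def blockNegCross {n : ℕ} (m : Fin n → EuclideanSpace ℝ (Fin 3)) :
    Matrix (Fin n × Fin 3) (Fin n × Fin 3) ℝ :=
  Matrix.of fun p q => if p.1 = q.1 then negCrossMat (m p.1) p.2 q.2 else 0

open Matrix in
theorem blockNegCross_transpose {n : ℕ} (m : Fin n → EuclideanSpace ℝ (Fin 3)) :
    (blockNegCross m)ᵀ = -blockNegCross m := by
  ext ⟨i, a⟩ ⟨j, b⟩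
  by_cases hij : i = j
  · subst hij
    simpa [blockNegCross] using congrFun₂ (negCrossMat_transpose (m i)) a b
  · simp [blockNegCross, hij, Ne.symm hij]

theorem blockD_eq {n : ℕ} (α : ℝ) (m : Fin n → EuclideanSpace ℝ (Fin 3)) :
    blockD n α m = blockNegCross m - α • (blockNegCross m * blockNegCross m) := by
  ext ⟨i, a⟩ ⟨j, b⟩
  by_cases hij : i = j
  · subst hij
    simp [blockD, blockNegCross, DmMat_eq, Matrix.mul_apply, Fintype.sum_prod_type_right]
  · simp [blockD, blockNegCross, hij, Matrix.mul_apply, Fintype.sum_prod_type_right]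

/-- for `n ≥ 1`, unit vectors `m`, `α > 0`, `ω > 0` and `H` real symmetric,
the matrix `M_ω = (i·ω)·I − D_ℂ · H_ℂ` is invertible. -/
theorem Momega_isUnit (n : ℕ) (hn : 1 ≤ n) (m : Fin n → EuclideanSpace ℝ (Fin 3))
    (hm : ∀ i, ‖m i‖ = 1) (α ω : ℝ) (hα : 0 < α) (hω : 0 < ω)
    (H : Matrix (Fin n × Fin 3) (Fin n × Fin 3) ℝ) (hH : H.IsSymm) :
    IsUnit ((Complex.I * ω) • (1 : Matrix (Fin n × Fin 3) (Fin n × Fin 3) ℂ) -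
      (blockD n α m).map (algebraMap ℝ ℂ) * H.map (algebraMap ℝ ℂ)) := by
  have hS : ((blockNegCross m).map (algebraMap ℝ ℂ)).conjTranspose =
      -(blockNegCross m).map (algebraMap ℝ ℂ) := by
    ext p q
    have := congrFun₂ (blockNegCross_transpose m) p q
    simp only [Matrix.transpose_apply, Matrix.neg_apply] at this
    simp [this]
  have hHc : (H.map (algebraMap ℝ ℂ)).IsHermitian := by
    ext p q
    simp [hH.apply p q]
  have hD : (blockD n α m).map (algebraMap ℝ ℂ) = (blockNegCross m).map (algebraMap ℝ ℂ) -
      (α : ℂ) • ((blockNegCross m).map (algebraMap ℝ ℂ) *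
        (blockNegCross m).map (algebraMap ℝ ℂ)) := by
    rw [blockD_eq, ← Matrix.map_mul]
    ext p q
    simp
  rw [hD]
  exact isUnit_I_smul_one_sub_skew_mul hS hHc hα.ne' hω.ne'
end
end

section
/- Let n ≥ 1, let m : Fin n → ℝ³ be a family of unit vectors, let α > 0 and ω > 0 be real numbers, and let H be a real symmetric matrix indexed by (Fin n) × (Fin 3). If U, Y ∈ ℂ^(3n) satisfy ((i·ω)·I − D_ℂ · H_ℂ) · U = D_ℂ · Y, then U belongs to [m]^⊥, i.e. for every i ∈ Fin n one has ∑_{k ∈ Fin 3} (m i)_k · U_(i,k) = 0. -/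
noncomputable section

/-- The columns of the matrix of `D_m` are orthogonal to `m`. -/
theorem sum_mul_DmMat (α : ℝ) (m : EuclideanSpace ℝ (Fin 3)) (j : Fin 3) :
    ∑ k : Fin 3, m k * DmMat α m k j = 0 := by
  fin_cases j <;> simp [Fin.sum_univ_three, DmMat, Dmap, cross3] <;> ring

/-- The range of the complexified block-diagonal matrix `D` lies in `[m]^⊥`. -/
theorem sum_mul_blockD_mulVec (n : ℕ) (α : ℝ) (m : Fin n → EuclideanSpace ℝ (Fin 3))
    (W : Fin n × Fin 3 → ℂ) (i : Fin n) :
    ∑ k : Fin 3, (m i k : ℂ) * ((blockD n α m).map (algebraMap ℝ ℂ)).mulVec W (i, k) = 0 := by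
  simp only [Matrix.mulVec, dotProduct, Finset.mul_sum]
  rw [Finset.sum_comm]
  refine Finset.sum_eq_zero fun q _ => ?_
  simp only [← mul_assoc, ← Finset.sum_mul]
  refine mul_eq_zero_of_left ?_ _
  by_cases h : i = q.1
  · simpa [blockD, h] using congrArg (fun x : ℝ => (x : ℂ)) (sum_mul_DmMat α (m i) q.2)
  · simp [blockD, h]

/-- any solution `U` of `((i·ω)·I − D_ℂ·H_ℂ) U = D_ℂ Y` lies in `[m]^⊥`. -/
theorem solution_mem_perp (n : ℕ) (hn : 1 ≤ n) (m : Fin n → EuclideanSpace ℝ (Fin 3))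
    (hm : ∀ i, ‖m i‖ = 1) (α ω : ℝ) (hα : 0 < α) (hω : 0 < ω)
    (H : Matrix (Fin n × Fin 3) (Fin n × Fin 3) ℝ) (hH : H.IsSymm)
    (U Y : Fin n × Fin 3 → ℂ)
    (hU : ((Complex.I * ω) • (1 : Matrix (Fin n × Fin 3) (Fin n × Fin 3) ℂ) -
        (blockD n α m).map (algebraMap ℝ ℂ) * H.map (algebraMap ℝ ℂ)).mulVec U =
      ((blockD n α m).map (algebraMap ℝ ℂ)).mulVec Y) :
    ∀ i : Fin n, ∑ k : Fin 3, (m i k : ℂ) * U (i, k) = 0 := by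
  intro i
  set D := (blockD n α m).map (algebraMap ℝ ℂ) with hD
  set K := H.map (algebraMap ℝ ℂ)
  have hrange : (Complex.I * ω) • U = D.mulVec (K.mulVec U + Y) := by
    rw [Matrix.sub_mulVec, Matrix.smul_mulVec, Matrix.one_mulVec, ← Matrix.mulVec_mulVec,
      sub_eq_iff_eq_add'] at hU
    rw [hU, Matrix.mulVec_add]
  have hperp := sum_mul_blockD_mulVec n α m (K.mulVec U + Y) i
  rw [← hD, ← hrange] at hperp
  simp only [Pi.smul_apply, smul_eq_mul, mul_left_comm _ (Complex.I * (ω : ℂ)),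
    ← Finset.mul_sum] at hperp
  refine (mul_eq_zero.mp hperp).resolve_left (mul_ne_zero Complex.I_ne_zero ?_)
  exact_mod_cast hω.ne'
end
end

section
/- Let n ≥ 1, let m : Fin n → ℝ³ be a family of unit vectors, let α > 0 be real, and let H be a real symmetric matrix indexed by (Fin n) × (Fin 3). Then every nonzero complex eigenvalue μ of the complex matrix D_ℂ · H_ℂ has nonvanishing real part: if (D_ℂ · H_ℂ) · U = μ • U with U ≠ 0 and μ ≠ 0, then Re(μ) ≠ 0. -/
noncomputable section

open scoped Matrix

/-- The quadratic form of the block `D_m` at a complex vector `v` has real part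
`α ‖m ×ᵥ v‖²`. -/
lemma re_star_dotProduct_DmMat (α : ℝ) (m : EuclideanSpace ℝ (Fin 3)) (v : Fin 3 → ℂ) :
    (∑ i, star (v i) * ∑ j, (DmMat α m i j : ℂ) * v j).re =
      α * ∑ i, Complex.normSq (crossProduct (fun k => (m k : ℂ)) v i) := by
  simp [DmMat, Dmap, cross3, Fin.sum_univ_three, Complex.normSq_apply, cross_apply]
  ring

/-- The block `D_m` annihilates every complex vector whose cross product with `m` vanishes. -/
lemma DmMat_mulVec_eq_zero (α : ℝ) (m : EuclideanSpace ℝ (Fin 3)) (v : Fin 3 → ℂ)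
    (h : crossProduct (fun k => (m k : ℂ)) v = 0) (i : Fin 3) :
    ∑ j, (DmMat α m i j : ℂ) * v j = 0 := by
  have h0 := congrFun h 0
  have h1 := congrFun h 1
  have h2 := congrFun h 2
  simp only [cross_apply, Matrix.cons_val, Pi.zero_apply] at h0 h1 h2
  fin_cases i <;> simp [DmMat, Dmap, cross3, Fin.sum_univ_three]
  · linear_combination -h0 - α * (m 1 * h2 - m 2 * h1)
  · linear_combination -h1 - α * (m 2 * h0 - m 0 * h2)
  · linear_combination -h2 - α * (m 0 * h1 - m 1 * h0)

/-- The complexified block-diagonal matrix acts blockwise. -/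
lemma blockD_map_mulVec_apply (n : ℕ) (α : ℝ) (m : Fin n → EuclideanSpace ℝ (Fin 3))
    (v : Fin n × Fin 3 → ℂ) (k : Fin n) (i : Fin 3) :
    ((blockD n α m).map (algebraMap ℝ ℂ)).mulVec v (k, i) =
      ∑ j, (DmMat α (m k) i j : ℂ) * v (k, j) := by
  simp only [Matrix.mulVec, dotProduct, Fintype.sum_prod_type, Matrix.map_apply, blockD,
    Matrix.of_apply]
  rw [Finset.sum_eq_single k]
  · simp
  · intro b _ hb
    simp [hb.symm]
  · simp

/-- The Hermitian form of a complexified real symmetric matrix is real-valued. -/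
lemma im_star_mulVec_dotProduct {ι : Type*} [Fintype ι] {H : Matrix ι ι ℝ} (hH : H.IsSymm)
    (U : ι → ℂ) : (star ((H.map (algebraMap ℝ ℂ)).mulVec U) ⬝ᵥ U).im = 0 := by
  have hs : (H.map (algebraMap ℝ ℂ)).IsHermitian := by
    ext i j
    simp [hH.apply i j]
  rw [Matrix.star_mulVec, hs.eq, ← Matrix.dotProduct_mulVec]
  exact hs.im_star_dotProduct_mulVec_self U

/-- every nonzero eigenvalue of `D_ℂ · H_ℂ` has nonvanishing real part. -/
theorem eigenvalue_re_ne_zero (n : ℕ) (hn : 1 ≤ n) (m : Fin n → EuclideanSpace ℝ (Fin 3))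
    (hm : ∀ i, ‖m i‖ = 1) (α : ℝ) (hα : 0 < α)
    (H : Matrix (Fin n × Fin 3) (Fin n × Fin 3) ℝ) (hH : H.IsSymm)
    (μ : ℂ) (U : Fin n × Fin 3 → ℂ)
    (hU : ((blockD n α m).map (algebraMap ℝ ℂ) * H.map (algebraMap ℝ ℂ)).mulVec U = μ • U)
    (hU0 : U ≠ 0) (hμ : μ ≠ 0) :
    μ.re ≠ 0 := by
  intro hre
  set V := (H.map (algebraMap ℝ ℂ)).mulVec U with hV
  rw [← Matrix.mulVec_mulVec, ← hV] at hU
  have hform : (star V ⬝ᵥ ((blockD n α m).map (algebraMap ℝ ℂ)).mulVec V).re = 0 := by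
    rw [hU, dotProduct_smul, smul_eq_mul, Complex.mul_re, hre, hV,
      im_star_mulVec_dotProduct hH]
    simp
  have hsum : ∑ k, α * ∑ i, Complex.normSq
      (crossProduct (fun l => (m k l : ℂ)) (fun j => V (k, j)) i) = 0 := by
    rw [← hform]
    simp only [dotProduct, Fintype.sum_prod_type, blockD_map_mulVec_apply, Complex.re_sum (s := Finset.univ (α := Fin n)),
      ← re_star_dotProduct_DmMat, Pi.star_apply]
  have hnonneg (k : Fin n) : 0 ≤ ∑ i, Complex.normSq
      (crossProduct (fun l => (m k l : ℂ)) (fun j => V (k, j)) i) :=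
    Finset.sum_nonneg fun i _ => Complex.normSq_nonneg _
  have hcross (k : Fin n) : crossProduct (fun l => (m k l : ℂ)) (fun j => V (k, j)) = 0 := by
    have hk := (Finset.sum_eq_zero_iff_of_nonneg
      fun k _ => mul_nonneg hα.le (hnonneg k)).1 hsum k (Finset.mem_univ k)
    have hk' := (mul_eq_zero.1 hk).resolve_left hα.ne'
    ext i
    exact Complex.normSq_eq_zero.1 ((Finset.sum_eq_zero_iff_of_nonneg
      fun i _ => Complex.normSq_nonneg _).1 hk' i (Finset.mem_univ i))
  have hzero : μ • U = 0 := by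
    rw [← hU]
    ext ⟨k, i⟩
    rw [blockD_map_mulVec_apply]
    exact DmMat_mulVec_eq_zero α (m k) _ (hcross k) i
  exact (smul_ne_zero hμ hU0) hzero
end
end

section
/- Let α > 0 and let m ∈ ℝ³ be a unit vector. The matrix of the linear map D_m satisfies D_mᵀ · D_m = (1 + α²) • (I − m ⬝ mᵀ), i.e. D_mᵀ ∘ D_m equals (1 + α²) times the orthogonal projection onto the plane m^⊥. -/
noncomputable section

/-- For a unit vector `m`, the matrix of `D_m` is `α • (I − m ⬝ mᵀ) − [m]ₓ`, where `[m]ₓ` is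
the matrix of `w ↦ m ×ᵥ w`. -/
theorem DmMat_eq_s3 (α : ℝ) {x y z : ℝ} (h : x ^ 2 + y ^ 2 + z ^ 2 = 1) :
    DmMat α !₂[x, y, z] =
      !![α * (1 - x ^ 2), z - α * (x * y), -y - α * (x * z);
        -z - α * (x * y), α * (1 - y ^ 2), x - α * (y * z);
        y - α * (x * z), -x - α * (y * z), α * (1 - z ^ 2)] := by
  ext i j
  fin_cases i <;> fin_cases j <;> simp [DmMat, Dmap, cross3] <;> grind

/-- `D_mᵀ · D_m = (1 + α²) • (I − m ⬝ mᵀ)`, i.e. `(1 + α²)` times the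
orthogonal projection onto `m^⊥`. -/
theorem DmMat_transpose_mul_self (α : ℝ) (hα : 0 < α) (m : EuclideanSpace ℝ (Fin 3))
    (hm : ‖m‖ = 1) :
    (DmMat α m).transpose * DmMat α m =
      (1 + α ^ 2) • ((1 : Matrix (Fin 3) (Fin 3) ℝ) -
        Matrix.vecMulVec (fun i => m i) fun j => m j) := by
  obtain ⟨x, y, z, rfl⟩ : ∃ x y z : ℝ, m = !₂[x, y, z] :=
    ⟨m 0, m 1, m 2, by ext i; fin_cases i <;> rfl⟩
  have h : x ^ 2 + y ^ 2 + z ^ 2 = 1 := by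
    simpa [hm, Fin.sum_univ_three] using (EuclideanSpace.real_norm_sq_eq !₂[x, y, z]).symm
  rw [DmMat_eq_s3 α h]
  ext i j
  fin_cases i <;> fin_cases j <;>
    simp [Matrix.mul_apply, Fin.sum_univ_three] <;> grind
end
end

section
/- Let α > 0 and let m ∈ ℝ³ be a unit vector. The spectrum of the complexification of the 3×3 matrix of D_m (its image under the entrywise map ℝ → ℂ) is exactly the set {0, α + i, α − i}. -/
noncomputable section

/-- The characteristic polynomial of `D_m`, evaluated at a complex number, for arbitrary `m`. -/
theorem eval_charpoly_DmMat (α : ℝ) (m : EuclideanSpace ℝ (Fin 3)) (z : ℂ) :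
    ((DmMat α m).map (algebraMap ℝ ℂ)).charpoly.eval z =
      z * ((z - α * (‖m‖ : ℂ) ^ 2) ^ 2 + (‖m‖ : ℂ) ^ 2) := by
  have h : (‖m‖ : ℂ) ^ 2 = (m 0 : ℂ) ^ 2 + (m 1 : ℂ) ^ 2 + (m 2 : ℂ) ^ 2 := by
    have := EuclideanSpace.real_norm_sq_eq m
    rw [Fin.sum_univ_three] at this
    exact_mod_cast this
  rw [h, Matrix.eval_charpoly, Matrix.det_fin_three]
  simp [DmMat, Dmap, cross3, Matrix.scalar_apply]
  ring

/-- the spectrum of the complexified matrix of `D_m` is `{0, α + i, α − i}`. -/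
theorem spectrum_DmMat (α : ℝ) (hα : 0 < α) (m : EuclideanSpace ℝ (Fin 3)) (hm : ‖m‖ = 1) :
    spectrum ℂ ((DmMat α m).map (algebraMap ℝ ℂ)) =
      {0, (α : ℂ) + Complex.I, (α : ℂ) - Complex.I} := by
  ext z
  rw [Matrix.mem_spectrum_iff_isRoot_charpoly, Polynomial.IsRoot.def, eval_charpoly_DmMat, hm]
  have h : (z - α * ((1 : ℝ) : ℂ) ^ 2) ^ 2 + ((1 : ℝ) : ℂ) ^ 2 =
      (z - (α + Complex.I)) * (z - (α - Complex.I)) := by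
    push_cast
    linear_combination Complex.I_sq
  rw [h]
  simp [sub_eq_zero]
end
end

section
/- Let n ≥ 1, let m : Fin n → ℝ³ be a family of unit vectors and let α > 0. The operator norm (with respect to the Euclidean norm on ℝ^(3n)) of the block-diagonal matrix D built from m and α equals √(1 + α²). -/
noncomputable section

theorem sum_sq_Dmap (α : ℝ) (m w : EuclideanSpace ℝ (Fin 3)) (hm : ‖m‖ = 1) :
    ∑ k, Dmap α m w k ^ 2 = (1 + α ^ 2) * (∑ k, w k ^ 2 - (∑ k, m k * w k) ^ 2) := by
  have h : m 0 ^ 2 + m 1 ^ 2 + m 2 ^ 2 = 1 := by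
    have := EuclideanSpace.real_norm_sq_eq m
    rw [hm, Fin.sum_univ_three] at this
    linarith
  simp only [Fin.sum_univ_three, Dmap, cross3, PiLp.sub_apply, PiLp.neg_apply, PiLp.smul_apply,
    WithLp.equiv_symm_apply, Matrix.cons_val, smul_eq_mul]
  linear_combination ((w 0 ^ 2 + w 1 ^ 2 + w 2 ^ 2) *
      (1 + α ^ 2 * (m 0 ^ 2 + m 1 ^ 2 + m 2 ^ 2)) + α ^ 2 *
      (w 0 ^ 2 + w 1 ^ 2 + w 2 ^ 2 - (m 0 * w 0 + m 1 * w 1 + m 2 * w 2) ^ 2)) * h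

theorem DmMat_mulVec (α : ℝ) (m w : EuclideanSpace ℝ (Fin 3)) (k : Fin 3) :
    ∑ l, DmMat α m k l * w l = Dmap α m w k := by
  fin_cases k <;> simp [Fin.sum_univ_three, DmMat, Dmap, cross3] <;> ring

theorem blockD_apply (n : ℕ) (α : ℝ) (m : Fin n → EuclideanSpace ℝ (Fin 3))
    (v : EuclideanSpace ℝ (Fin n × Fin 3)) (i : Fin n) (k : Fin 3) :
    Matrix.toEuclideanCLM (𝕜 := ℝ) (blockD n α m) v (i, k) =
      Dmap α (m i) (WithLp.toLp 2 fun l => v (i, l)) k := by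
  rw [← DmMat_mulVec, Matrix.ofLp_toEuclideanCLM]
  simp [Matrix.mulVec, dotProduct, Fintype.sum_prod_type, blockD]

theorem norm_sq_blockD_apply (n : ℕ) (α : ℝ) (m : Fin n → EuclideanSpace ℝ (Fin 3))
    (hm : ∀ i, ‖m i‖ = 1) (v : EuclideanSpace ℝ (Fin n × Fin 3)) :
    ‖Matrix.toEuclideanCLM (𝕜 := ℝ) (blockD n α m) v‖ ^ 2 =
      (1 + α ^ 2) * (‖v‖ ^ 2 - ∑ i, (∑ k, m i k * v (i, k)) ^ 2) := by
  simp only [EuclideanSpace.real_norm_sq_eq, Fintype.sum_prod_type, blockD_apply,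
    sum_sq_Dmap α _ _ (hm _), ← Finset.mul_sum, Finset.sum_sub_distrib]

theorem exists_ne_zero_orthogonal (m : EuclideanSpace ℝ (Fin 3)) :
    ∃ w : Fin 3 → ℝ, w ≠ 0 ∧ ∑ k, m k * w k = 0 := by
  by_cases h : m 0 = 0
  · exact ⟨![1, 0, 0], fun h => one_ne_zero (congrFun h 0), by simp [Fin.sum_univ_three, h]⟩
  · refine ⟨![-m 1, m 0, 0], fun hw => h (congrFun hw 1), ?_⟩
    simp [Fin.sum_univ_three]
    ring

/-- the Euclidean operator norm of the block-diagonal matrix `D` built from a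
family of unit vectors `m` and `α > 0` equals `√(1 + α²)`. -/
theorem opNorm_blockD (n : ℕ) (hn : 1 ≤ n) (m : Fin n → EuclideanSpace ℝ (Fin 3))
    (hm : ∀ i, ‖m i‖ = 1) (α : ℝ) (hα : 0 < α) :
    ‖Matrix.toEuclideanCLM (𝕜 := ℝ) (blockD n α m)‖ = Real.sqrt (1 + α ^ 2) := by
  have hs : 0 ≤ 1 + α ^ 2 := by positivity
  refine ContinuousLinearMap.opNorm_eq_of_bounds (Real.sqrt_nonneg _) (fun v => ?_)
    fun N _ hN => ?_
  · refine le_of_sq_le_sq ?_ (by positivity)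
    rw [norm_sq_blockD_apply n α m hm, mul_pow, Real.sq_sqrt hs]
    gcongr
    exact sub_le_self _ (Finset.sum_nonneg fun i _ => sq_nonneg _)
  · obtain ⟨w, hw, hmw⟩ := exists_ne_zero_orthogonal (m ⟨0, hn⟩)
    let v : EuclideanSpace ℝ (Fin n × Fin 3) :=
      WithLp.toLp 2 fun p => if p.1 = ⟨0, hn⟩ then w p.2 else 0
    have hv : v ≠ 0 := fun h => hw <| funext fun k => by
      simpa [v] using congrArg (fun u : EuclideanSpace ℝ (Fin n × Fin 3) => u (⟨0, hn⟩, k)) h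
    have horth : ∑ i, (∑ k, m i k * v (i, k)) ^ 2 = 0 := by
      refine Finset.sum_eq_zero fun i _ => ?_
      by_cases hi : i = ⟨0, hn⟩
      · subst hi
        simp [v, hmw]
      · simp [v, hi]
    have hDv : ‖Matrix.toEuclideanCLM (𝕜 := ℝ) (blockD n α m) v‖ = √(1 + α ^ 2) * ‖v‖ := by
      rw [← sq_eq_sq₀ (norm_nonneg _) (by positivity), norm_sq_blockD_apply n α m hm, horth,
        mul_pow, Real.sq_sqrt hs, sub_zero]
    exact le_of_mul_le_mul_right (hDv ▸ hN v) (norm_pos_iff.mpr hv)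
end
end

section
/- Let H be a real symmetric n×n matrix and let ω > 0 and α > 0 be real numbers. Then the operator norm (with respect to the Euclidean norm on ℂⁿ) of H_ℂ · ((i·ω)·I − α • H_ℂ)⁻¹ is at most 1/α. -/
noncomputable section

/-- For a symmetric `T`, the vectors `(i·ω) x` and `α T x` are orthogonal over the reals, so
subtracting them cannot shorten the latter. -/
theorem norm_smul_apply_le_norm_I_smul_sub {E : Type*} [NormedAddCommGroup E]
    [InnerProductSpace ℂ E] {T : E →ₗ[ℂ] E} (hT : T.IsSymmetric) (ω α : ℝ) (x : E) :
    ‖(α : ℂ) • T x‖ ≤ ‖(Complex.I * ω) • x - (α : ℂ) • T x‖ := by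
  have him : (inner ℂ x (T x)).im = 0 := by
    rw [← Complex.conj_eq_iff_im, inner_conj_symm]
    exact hT x x
  have horth : (inner ℂ ((Complex.I * ω) • x) ((α : ℂ) • T x)).re = 0 := by
    simp [him]
  have h := norm_sub_sq (𝕜 := ℂ) ((Complex.I * ω) • x) ((α : ℂ) • T x)
  rw [RCLike.re_eq_complex_re, horth] at h
  refine le_of_sq_le_sq ?_ (norm_nonneg _)
  nlinarith [sq_nonneg ‖(Complex.I * ω) • x‖]

/-- for a real symmetric `H` and `ω > 0`, `α > 0`, the Euclidean operator norm
of `H_ℂ · ((i·ω)·I − α • H_ℂ)⁻¹` is at most `1/α`. -/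
theorem norm_H_mul_precond_inv_le (n : ℕ) (H : Matrix (Fin n) (Fin n) ℝ)
    (hH : H.IsSymm) (ω α : ℝ) (hω : 0 < ω) (hα : 0 < α) :
    ‖Matrix.toEuclideanCLM (𝕜 := ℂ)
        (H.map (algebraMap ℝ ℂ) *
          ((Complex.I * ω) • (1 : Matrix (Fin n) (Fin n) ℂ) -
            (α : ℂ) • H.map (algebraMap ℝ ℂ))⁻¹)‖ ≤ 1 / α := by
  set A : Matrix (Fin n) (Fin n) ℂ := H.map (algebraMap ℝ ℂ) with hA
  set M := (Complex.I * ω) • (1 : Matrix (Fin n) (Fin n) ℂ) - (α : ℂ) • A with hM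
  have hAself : IsSelfAdjoint A := by
    ext i j
    simp [hA, Matrix.star_apply, hH.apply i j]
  have hsymm : (Matrix.toEuclideanCLM (𝕜 := ℂ) A).toLinearMap.IsSymmetric :=
    (hAself.map (Matrix.toEuclideanCLM (n := Fin n) (𝕜 := ℂ))).isSymmetric
  by_cases hdet : IsUnit M.det
  · refine ContinuousLinearMap.opNorm_le_bound _ (by positivity) fun v ↦ ?_
    set x := Matrix.toEuclideanCLM (𝕜 := ℂ) M⁻¹ v with hx
    have hv : (Complex.I * ω) • x - (α : ℂ) • Matrix.toEuclideanCLM (𝕜 := ℂ) A x = v := by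
      have h : Matrix.toEuclideanCLM (𝕜 := ℂ) M x = v := by
        rw [hx, ← mul_apply_eq_comp, ← map_mul, Matrix.mul_nonsing_inv _ hdet,
          map_one, one_apply_eq_self]
      rw [hM, map_sub, map_smul, map_smul, map_one] at h
      exact h
    have hle := norm_smul_apply_le_norm_I_smul_sub hsymm ω α x
    rw [ContinuousLinearMap.coe_coe, hv, norm_smul, Complex.norm_real,
      Real.norm_of_nonneg hα.le] at hle
    rw [map_mul, mul_apply_eq_comp, ← hx, one_div, ← div_eq_inv_mul,
      le_div_iff₀' hα]
    exact hle
  · rw [Matrix.nonsing_inv_apply_not_isUnit _ hdet, mul_zero, map_zero, norm_zero]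
    positivity
end
end

section
/- Let n ≥ 1 and let M be an n×n complex matrix. Define c : Fin n → ℂ by c(k) = (1/n) · ∑_{j ∈ Fin n} M_{(j + k), j}. Then the circulant matrix generated by c is the best approximation of M among circulant matrices in the Frobenius norm: for every v : Fin n → ℂ, ‖M − circulant(c)‖_F ≤ ‖M − circulant(v)‖_F. -/
noncomputable section

/-- The Frobenius norm of a complex matrix. -/
def frobNorm {n : ℕ} (A : Matrix (Fin n) (Fin n) ℂ) : ℝ :=
  Real.sqrt (∑ i, ∑ j, ‖A i j‖ ^ 2)

/-- Any point `a` with `card ι • a = ∑ i, f i` minimizes the sum of squared distances to the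
family `f`. -/
theorem sum_norm_sub_sq_le_of_card_smul_eq_sum {ι E : Type*} [Fintype ι]
    [NormedAddCommGroup E] [InnerProductSpace ℝ E] (f : ι → E) (a w : E)
    (h : Fintype.card ι • a = ∑ i, f i) :
    ∑ i, ‖f i - a‖ ^ 2 ≤ ∑ i, ‖f i - w‖ ^ 2 := by
  have hz : ∑ i, (f i - a) = 0 := by
    simp [Finset.sum_sub_distrib, ← h]
  have hexp (i : ι) : ‖f i - w‖ ^ 2
      = ‖f i - a‖ ^ 2 + 2 * inner ℝ (f i - a) (a - w) + ‖a - w‖ ^ 2 := by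
    rw [← norm_add_sq_real, sub_add_sub_cancel]
  simp_rw [hexp, Finset.sum_add_distrib, ← Finset.mul_sum, ← sum_inner, hz, inner_zero_left,
    mul_zero, add_zero]
  exact le_add_of_nonneg_right (Finset.sum_nonneg fun _ _ => sq_nonneg _)

/-- The squared distance from `M` to a circulant matrix, summed along cyclic diagonals. -/
theorem sum_norm_sub_circulant_sq {G E : Type*} [AddCommGroup G] [Fintype G]
    [SeminormedAddCommGroup E] (M : Matrix G G E) (v : G → E) :
    ∑ i, ∑ j, ‖(M - Matrix.circulant v) i j‖ ^ 2 = ∑ k, ∑ j, ‖M (j + k) j - v k‖ ^ 2 := by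
  rw [Finset.sum_comm]
  conv_rhs => rw [Finset.sum_comm]
  refine Finset.sum_congr rfl fun j _ => ?_
  rw [← Equiv.sum_comp (Equiv.addLeft j)]
  simp [Matrix.circulant_apply]

/-- the circulant matrix generated by `c k = (1/n) ∑ j, M (j+k) j` is the best
Frobenius-norm approximation of `M` among circulant matrices. -/
theorem circulant_best_approx (n : ℕ) (hn : 1 ≤ n) (M : Matrix (Fin n) (Fin n) ℂ)
    (c : Fin n → ℂ) (hc : ∀ k, c k = (1 / (n : ℂ)) * ∑ j, M (j + k) j)
    (v : Fin n → ℂ) :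
    frobNorm (M - Matrix.circulant c) ≤ frobNorm (M - Matrix.circulant v) := by
  have : NeZero n := ⟨by omega⟩
  refine Real.sqrt_le_sqrt ?_
  rw [sum_norm_sub_circulant_sq, sum_norm_sub_circulant_sq]
  refine Finset.sum_le_sum fun k _ =>
    sum_norm_sub_sq_le_of_card_smul_eq_sum (fun j => M (j + k) j) (c k) (v k) ?_
  have hn0 : (n : ℂ) ≠ 0 := NeZero.ne _
  rw [Fintype.card_fin, nsmul_eq_mul, hc]
  field_simp
end
end

section
/- Let n ≥ 1 and let M be an n×n complex matrix. Define c : Fin n → ℂ by c(k) = (1/n) · ∑_{j ∈ Fin n} M_{(j + k), j}. Then the difference M − circulant(c) is Frobenius-orthogonal to every circulant matrix: for every v : Fin n → ℂ, the trace of (circulant(v))ᴴ · (M − circulant(c)) equals 0, where ᴴ denotes the conjugate transpose. -/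
noncomputable section

/-- The Frobenius pairing of a circulant matrix with `A` only depends on the sums of `A` along
its cyclic diagonals. -/
theorem Matrix.trace_conjTranspose_circulant_mul {G R : Type*} [AddCommGroup G] [Fintype G]
    [NonUnitalNonAssocSemiring R] [StarRing R] (v : G → R) (A : Matrix G G R) :
    Matrix.trace ((Matrix.circulant v).conjTranspose * A) =
      ∑ k, star (v k) * ∑ j, A (j + k) j := by
  simp only [Matrix.trace, Matrix.diag_apply, Matrix.mul_apply, Matrix.conjTranspose_apply,
    Matrix.circulant_apply, Finset.mul_sum]
  rw [Finset.sum_comm (f := fun k j => star (v k) * A (j + k) j)]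
  refine Finset.sum_congr rfl fun j _ => ?_
  rw [← Equiv.sum_comp (Equiv.addLeft j)]
  simp

/-- `M − circulant(c)`, with `c k = (1/n) ∑ j, M (j+k) j`, is
Frobenius-orthogonal to every circulant matrix. -/
theorem circulant_residual_orthogonal (n : ℕ) (hn : 1 ≤ n) (M : Matrix (Fin n) (Fin n) ℂ)
    (c : Fin n → ℂ) (hc : ∀ k, c k = (1 / (n : ℂ)) * ∑ j, M (j + k) j)
    (v : Fin n → ℂ) :
    Matrix.trace ((Matrix.circulant v).conjTranspose * (M - Matrix.circulant c)) = 0 := by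
  have : NeZero n := ⟨by omega⟩
  have hn0 : (n : ℂ) ≠ 0 := NeZero.ne _
  have hk (k : Fin n) : ∑ j, (M - Matrix.circulant c) (j + k) j = 0 := by
    simp [hc, hn0]
  rw [Matrix.trace_conjTranspose_circulant_mul]
  simp only [hk, mul_zero, Finset.sum_const_zero]
end
end

section
/- Let n ≥ 1, let m : Fin n → ℝ³ be a family of unit vectors, let α > 0 and ω > 0 be real numbers, and let H be a real symmetric matrix indexed by (Fin n) × (Fin 3). Then the operator norm (with respect to the Euclidean norm on ℂ^(3n)) of M_ω = (i·ω)·I − D_ℂ · H_ℂ satisfies ‖M_ω‖ ≤ ω + √(1 + α²) · ‖H‖, where ‖H‖ is the operator norm of H on ℝ^(3n). -/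
noncomputable section

/-- Complexifying a real square matrix does not increase its Euclidean operator norm. -/
theorem norm_toEuclideanCLM_map_algebraMap_le {ι : Type*} [Fintype ι] [DecidableEq ι]
    (A : Matrix ι ι ℝ) :
    ‖Matrix.toEuclideanCLM (𝕜 := ℂ) (A.map (algebraMap ℝ ℂ))‖ ≤
      ‖Matrix.toEuclideanCLM (𝕜 := ℝ) A‖ := by
  refine ContinuousLinearMap.opNorm_le_bound _ (norm_nonneg _) fun z => ?_
  let x : EuclideanSpace ℝ ι := WithLp.toLp 2 fun i => (z i).re
  let y : EuclideanSpace ℝ ι := WithLp.toLp 2 fun i => (z i).im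
  have hz : ‖z‖ ^ 2 = ‖x‖ ^ 2 + ‖y‖ ^ 2 := by
    simp only [EuclideanSpace.norm_sq_eq, ← Finset.sum_add_distrib]
    refine Finset.sum_congr rfl fun i _ => ?_
    rw [Complex.sq_norm, Complex.normSq_apply]
    simp [x, y, sq]
  have hA : ‖Matrix.toEuclideanCLM (𝕜 := ℂ) (A.map (algebraMap ℝ ℂ)) z‖ ^ 2 =
      ‖Matrix.toEuclideanCLM (𝕜 := ℝ) A x‖ ^ 2 + ‖Matrix.toEuclideanCLM (𝕜 := ℝ) A y‖ ^ 2 := by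
    simp only [EuclideanSpace.norm_sq_eq, ← Finset.sum_add_distrib]
    refine Finset.sum_congr rfl fun i _ => ?_
    rw [Complex.sq_norm, Complex.normSq_apply]
    simp [x, y, Matrix.ofLp_toEuclideanCLM, sq, Matrix.mulVec, dotProduct]
  refine (sq_le_sq₀ (norm_nonneg _) (by positivity)).1 ?_
  rw [mul_pow, hz, hA, mul_add, ← mul_pow, ← mul_pow]
  gcongr <;> exact ContinuousLinearMap.le_opNorm _ _

/-- For a unit vector `m`, the matrix of `D_m` is bounded by `√(1 + α²)`. -/
theorem sum_sq_DmMat_mulVec_le (α : ℝ) {m : EuclideanSpace ℝ (Fin 3)} (hm : ‖m‖ = 1)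
    (w : Fin 3 → ℝ) :
    ∑ j, ((DmMat α m).mulVec w j) ^ 2 ≤ (1 + α ^ 2) * ∑ j, w j ^ 2 := by
  have h : m 0 ^ 2 + m 1 ^ 2 + m 2 ^ 2 = 1 := by
    have := EuclideanSpace.norm_sq_eq m
    simp only [hm, Fin.sum_univ_three, Real.norm_eq_abs, sq_abs] at this
    linarith
  have key : ∑ j, ((DmMat α m).mulVec w j) ^ 2 =
      (1 + α ^ 2 * (m 0 ^ 2 + m 1 ^ 2 + m 2 ^ 2)) *
        ((m 0 ^ 2 + m 1 ^ 2 + m 2 ^ 2) * ∑ j, w j ^ 2 -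
          (m 0 * w 0 + m 1 * w 1 + m 2 * w 2) ^ 2) := by
    simp [Matrix.mulVec, dotProduct, DmMat, Dmap, cross3, Fin.sum_univ_three]
    ring
  rw [key, h, mul_one, one_mul]
  gcongr
  exact sub_le_self _ (sq_nonneg _)

/-- The block-diagonal matrix `D` is bounded by `√(1 + α²)`. -/
theorem norm_toEuclideanCLM_blockD_le {n : ℕ} {m : Fin n → EuclideanSpace ℝ (Fin 3)}
    (hm : ∀ i, ‖m i‖ = 1) (α : ℝ) :
    ‖Matrix.toEuclideanCLM (𝕜 := ℝ) (blockD n α m)‖ ≤ √(1 + α ^ 2) := by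
  refine ContinuousLinearMap.opNorm_le_bound _ (Real.sqrt_nonneg _) fun v => ?_
  refine (sq_le_sq₀ (norm_nonneg _) (by positivity)).1 ?_
  rw [mul_pow, Real.sq_sqrt (by positivity)]
  have h (i : Fin n) (j : Fin 3) : (Matrix.toEuclideanCLM (𝕜 := ℝ) (blockD n α m) v) (i, j) =
      (DmMat α (m i)).mulVec (fun k => v (i, k)) j := by
    simp [Matrix.ofLp_toEuclideanCLM, Matrix.mulVec, dotProduct, Fintype.sum_prod_type, blockD,
      ite_mul, Finset.sum_ite_irrel]
  simp only [EuclideanSpace.norm_sq_eq, Fintype.sum_prod_type, Real.norm_eq_abs, sq_abs, h]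
  rw [Finset.mul_sum]
  exact Finset.sum_le_sum fun i _ => sum_sq_DmMat_mulVec_le α (hm i) _

/-- the Euclidean operator norm of `M_ω = (i·ω)·I − D_ℂ · H_ℂ` is at most
`ω + √(1 + α²) · ‖H‖`, where `‖H‖` is the Euclidean operator norm of `H`. -/
theorem norm_Momega_le (n : ℕ) (hn : 1 ≤ n) (m : Fin n → EuclideanSpace ℝ (Fin 3))
    (hm : ∀ i, ‖m i‖ = 1) (α ω : ℝ) (hα : 0 < α) (hω : 0 < ω)
    (H : Matrix (Fin n × Fin 3) (Fin n × Fin 3) ℝ) (hH : H.IsSymm) :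
    ‖Matrix.toEuclideanCLM (𝕜 := ℂ)
        ((Complex.I * ω) • (1 : Matrix (Fin n × Fin 3) (Fin n × Fin 3) ℂ) -
          (blockD n α m).map (algebraMap ℝ ℂ) * H.map (algebraMap ℝ ℂ))‖ ≤
      ω + Real.sqrt (1 + α ^ 2) * ‖Matrix.toEuclideanCLM (𝕜 := ℝ) H‖ := by
  rw [map_sub, map_smul, map_one, map_mul]
  refine (norm_sub_le _ _).trans (add_le_add ?_ ?_)
  · rw [norm_smul]
    have h : ‖Complex.I * (ω : ℂ)‖ = ω := by simp [abs_of_pos hω]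
    rw [h]
    exact mul_le_of_le_one_right hω.le ContinuousLinearMap.norm_id_le
  · refine (norm_mul_le _ _).trans ?_
    gcongr
    · exact (norm_toEuclideanCLM_map_algebraMap_le _).trans (norm_toEuclideanCLM_blockD_le hm α)
    · exact norm_toEuclideanCLM_map_algebraMap_le H
end
end
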